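/- The set B = {sd(H,G) : G a finite group, H ≤ G} of all relative subgroup commutativity degrees is dense in the interval [0,1]. -/

import Mathlib

open scoped Pointwise

/-- Two subgroups permute if `HK = KH` as subsets. -/
def Permutes {G : Type*} [Group G] (A B : Subgroup G) : Prop :=
  (A : Set G) * (B : Set G) = (B : Set G) * (A : Set G)

/-- The subgroup commutativity degree of a group `G`. -/
noncomputable def sd (G : Type*) [Group G] : ℚ :=
  (Nat.card {p : Subgroup G × Subgroup G // Permutes p.1 p.2} : ℚ) /
    (Nat.card (Subgroup G) : ℚ) ^ 2

/-- The relative subgroup commutativity degree of a subgroup `H` of `G`. -/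
noncomputable def rsd {G : Type*} [Group G] (H : Subgroup G) : ℚ :=
  (Nat.card {p : {K : Subgroup G // K ≤ H} × Subgroup G // Permutes p.1.1 p.2} : ℚ) /
    ((Nat.card {K : Subgroup G // K ≤ H} : ℚ) * (Nat.card (Subgroup G) : ℚ))

section

open SemidirectProduct

/-- A finite cyclic group of prime power order `p ^ n` has exactly `n + 1` subgroups. -/
theorem IsCyclic.card_subgroup_of_card_eq_prime_pow {C : Type*} [CommGroup C] [IsCyclic C]
    {p n : ℕ} (hp : p.Prime) (hC : Nat.card C = p ^ n) : Nat.card (Subgroup C) = n + 1 := by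
  have : Finite C := Nat.finite_of_card_ne_zero (by rw [hC]; exact (pow_pos hp.pos n).ne')
  have hcard : ∀ i ≤ n, Nat.card (powMonoidHom (p ^ i) : C →* C).ker = p ^ i := fun i hi ↦ by
    rw [IsCyclic.card_powMonoidHom_ker, hC]
    exact Nat.gcd_eq_right (pow_dvd_pow p hi)
  have hbij : Function.Bijective
      (fun i : Fin (n + 1) ↦ (powMonoidHom (p ^ (i : ℕ)) : C →* C).ker) := by
    constructor
    · intro i j hij
      have h := congrArg (fun K : Subgroup C ↦ Nat.card K) hij
      simp only [hcard _ (Nat.lt_succ_iff.1 i.2), hcard _ (Nat.lt_succ_iff.1 j.2)] at h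
      exact Fin.ext (Nat.pow_right_injective hp.two_le h)
    · intro K
      obtain ⟨i, hi, hK⟩ := (Nat.dvd_prime_pow hp).1 (hC ▸ Subgroup.card_subgroup_dvd_card K)
      refine ⟨⟨i, Nat.lt_succ_of_le hi⟩, (Subgroup.eq_of_le_of_card_ge ?_ ?_).symm⟩
      · intro x hx
        have h := pow_card_eq_one' (x := (⟨x, hx⟩ : K))
        rw [hK] at h
        simpa [MonoidHom.mem_ker] using congrArg Subtype.val h
      · rw [hcard i hi, hK]
  rw [← Nat.card_congr (Equiv.ofBijective _ hbij), Nat.card_fin]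

/-- The number of subgroups of `G` contained in `H` is the number of subgroups of `H`. -/
theorem Subgroup.card_subtype_le {G : Type*} [Group G] (H : Subgroup G) :
    Nat.card {K : Subgroup G // K ≤ H} = Nat.card (Subgroup H) :=
  (Nat.card_congr (Subgroup.MapSubtype.orderIso H).toEquiv).symm

/-- A central subgroup permutes with every subgroup. -/
theorem permutes_of_le_center {G : Type*} [Group G] {A : Subgroup G}
    (hA : A ≤ Subgroup.center G) (B : Subgroup G) : Permutes A B := by
  ext x
  simp only [Set.mem_mul, SetLike.mem_coe]
  constructor
  · rintro ⟨a, ha, b, hb, rfl⟩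
    exact ⟨b, hb, a, ha, Subgroup.mem_center_iff.1 (hA ha) b⟩
  · rintro ⟨b, hb, a, ha, rfl⟩
    exact ⟨a, ha, b, hb, (Subgroup.mem_center_iff.1 (hA ha) b).symm⟩

section PrimeKernel

variable {N H : Type*} [Group N] [CommGroup H] (φ : H →* MulAut N)

/-- A nontrivial automorphism of a group of prime order has no nontrivial fixed point. -/
theorem MulAut.eq_one_of_apply_eq_self (hN : (Nat.card N).Prime) {f : MulAut N}
    (hf : f ≠ 1) {x : N} (hx : f x = x) : x = 1 := by
  have := Fact.mk hN
  by_contra hx1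
  refine hf (MulEquiv.ext fun y ↦ ?_)
  obtain ⟨k, rfl⟩ := Subgroup.mem_zpowers_iff.1 (mem_zpowers_of_prime_card (g' := y) rfl hx1)
  simp [hx]

theorem SemidirectProduct.mem_range_inl {x : N ⋊[φ] H} :
    x ∈ (inl : N →* N ⋊[φ] H).range ↔ x.right = 1 := by
  rw [range_inl_eq_ker_rightHom, MonoidHom.mem_ker, rightHom_eq_right]

theorem SemidirectProduct.mem_range_inr {x : N ⋊[φ] H} :
    x ∈ (inr : H →* N ⋊[φ] H).range ↔ x.left = 1 := by
  constructor
  · rintro ⟨h, rfl⟩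
    exact left_inr h
  · intro h
    exact ⟨x.right, by ext <;> simp [h]⟩

/-- The image in `N ⋊[φ] H` of the kernel of the action is central. -/
theorem SemidirectProduct.map_inr_ker_le_center :
    φ.ker.map (inr : H →* N ⋊[φ] H) ≤ Subgroup.center (N ⋊[φ] H) := by
  rintro _ ⟨k, hk, rfl⟩
  have hk : φ k = 1 := hk
  refine Subgroup.mem_center_iff.2 fun g ↦ ?_
  ext
  · simp [hk]
  · simp [mul_comm]

/-- A subgroup of `N ⋊[φ] H` not containing `N`, where `N` has prime order, meets `N` trivially. -/
theorem SemidirectProduct.eq_one_of_mem_of_right_eq_one (hN : (Nat.card N).Prime)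
    {P : Subgroup (N ⋊[φ] H)} (hP : ¬ (inl : N →* N ⋊[φ] H).range ≤ P) {x : N ⋊[φ] H}
    (hx : x ∈ P) (hx1 : x.right = 1) : x = 1 := by
  have := Fact.mk hN
  obtain ⟨n, rfl⟩ := (mem_range_inl φ).2 hx1
  by_contra hn
  refine hP ?_
  rintro _ ⟨m, rfl⟩
  have hn' : n ≠ 1 := fun h ↦ hn (by rw [h, map_one])
  obtain ⟨k, rfl⟩ := Subgroup.mem_zpowers_iff.1 (mem_zpowers_of_prime_card (g' := m) rfl hn')
  rw [map_zpow]
  exact P.zpow_mem hx k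

/-- In `N ⋊[φ] H`, with `N` of prime order larger than the order of `H`, a subgroup permuting with
a subgroup of `H` that acts nontrivially either contains `N` or is contained in `H`. -/
theorem SemidirectProduct.range_inl_le_or_le_range_inr [Finite H] (hN : (Nat.card N).Prime)
    (hNH : Nat.card H < Nat.card N) {K P : Subgroup (N ⋊[φ] H)}
    (hK : K ≤ (inr : H →* N ⋊[φ] H).range) (hKφ : ¬ K ≤ φ.ker.map inr) (hKP : Permutes K P) :
    (inl : N →* N ⋊[φ] H).range ≤ P ∨ P ≤ (inr : H →* N ⋊[φ] H).range := by
  have : Finite N := Nat.finite_of_card_ne_zero hN.ne_zero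
  refine or_iff_not_imp_left.2 fun hP g hg ↦ ?_
  obtain ⟨_, hkK, hkφ⟩ := SetLike.not_le_iff_exists.1 hKφ
  obtain ⟨k, rfl⟩ := hK hkK
  have hk : φ k ≠ 1 := fun h ↦ hkφ ⟨k, h, rfl⟩
  have hS : (↑(P ⊔ K) : Set (N ⋊[φ] H)) = P * K := by
    apply Set.Subset.antisymm
    · have hKP : (K : Set (N ⋊[φ] H)) * P = P * K := hKP
      let S : Subgroup (N ⋊[φ] H) :=
        { carrier := P * K
          one_mem' := ⟨1, P.one_mem, 1, K.one_mem, mul_one 1⟩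
          mul_mem' := fun {a b} ha hb ↦ by
            have h : (P * K * (P * K) : Set (N ⋊[φ] H)) = P * K := by
              rw [mul_assoc, ← mul_assoc (K : Set (N ⋊[φ] H)), hKP, mul_assoc, coe_mul_coe,
                ← mul_assoc, coe_mul_coe]
            exact h ▸ Set.mul_mem_mul ha hb
          inv_mem' := by
            rintro _ ⟨a, ha, b, hb, rfl⟩
            rw [← hKP]
            exact ⟨b⁻¹, K.inv_mem hb, a⁻¹, P.inv_mem ha, (mul_inv_rev a b).symm⟩ }
      exact sup_le (c := S) (fun x hx ↦ ⟨x, hx, 1, K.one_mem, mul_one x⟩)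
        (fun x hx ↦ ⟨1, P.one_mem, x, hx, one_mul x⟩)
    · rintro _ ⟨a, ha, b, hb, rfl⟩
      exact mul_mem (Subgroup.mem_sup_left ha) (Subgroup.mem_sup_right hb)
  have hNS : ¬ (inl : N →* N ⋊[φ] H).range ≤ P ⊔ K := by
    intro hle
    have hdec : ∀ n : N, ∃ a ∈ P, ∃ b ∈ K, a * b = inl n := fun n ↦ by
      have h : inl n ∈ (↑(P ⊔ K) : Set (N ⋊[φ] H)) := hle ⟨n, rfl⟩
      rwa [hS] at h
    choose a ha b hb hab using hdec
    refine hNH.not_ge (Nat.card_le_card_of_injective (fun n ↦ (b n).right) fun m n hmn ↦ ?_)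
    have hbmn : b m = b n := by
      ext
      · rw [(mem_range_inr φ).1 (hK (hb m)), (mem_range_inr φ).1 (hK (hb n))]
      · exact hmn
    have hmul : a m * (a n)⁻¹ = inl (m * n⁻¹) := by
      rw [map_mul, map_inv, ← hab m, ← hab n, hbmn]
      group
    have h1 := eq_one_of_mem_of_right_eq_one φ hN hP (P.mul_mem (ha m) (P.inv_mem (ha n)))
      (by rw [hmul, right_inl])
    rw [hmul, ← map_one inl, inl_inj] at h1
    exact mul_inv_eq_one.1 h1
  have hcomm := eq_one_of_mem_of_right_eq_one φ hN hNS (x := inr k * g * (inr k)⁻¹ * g⁻¹)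
    (mul_mem (mul_mem (mul_mem (Subgroup.mem_sup_right hkK) (Subgroup.mem_sup_left hg))
      (inv_mem (Subgroup.mem_sup_right hkK))) (inv_mem (Subgroup.mem_sup_left hg)))
    (by simp)
  have hfix : inr k * g = g * inr k := by
    rwa [mul_inv_eq_one, mul_inv_eq_iff_eq_mul] at hcomm
  refine (mem_range_inr φ).2 (MulAut.eq_one_of_apply_eq_self hN hk ?_)
  simpa using congrArg SemidirectProduct.left hfix

/-- If the action of `H` on `N` is nontrivial, then `N ⋊[φ] H` has at least `|N|` subgroups, namely
the conjugates of `H` by elements of `N`. -/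
theorem SemidirectProduct.card_le_card_subgroup [Finite H] (hN : (Nat.card N).Prime) (hφ : φ ≠ 1) :
    Nat.card N ≤ Nat.card (Subgroup (N ⋊[φ] H)) := by
  have : Finite N := Nat.finite_of_card_ne_zero hN.ne_zero
  have : Finite (N ⋊[φ] H) := Finite.of_equiv _ SemidirectProduct.equivProd.symm
  obtain ⟨k, hk⟩ : ∃ k, φ k ≠ 1 := by
    by_contra! h
    exact hφ (MonoidHom.ext h)
  refine Nat.card_le_card_of_injective
    (fun n ↦ (inr : H →* N ⋊[φ] H).range.map (MulAut.conj (inl n)).toMonoidHom)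
    fun m n hmn ↦ ?_
  have hmem : inl m * inr k * (inl m)⁻¹ ∈
      (inr : H →* N ⋊[φ] H).range.map (MulAut.conj (inl n)).toMonoidHom := by
    simp only at hmn
    rw [← hmn]
    exact ⟨inr k, ⟨k, rfl⟩, rfl⟩
  obtain ⟨_, ⟨h, rfl⟩, hh⟩ := hmem
  replace hh : inl n * inr h * (inl n)⁻¹ = inl m * inr k * (inl m)⁻¹ := hh
  have hr : h = k := by simpa using congrArg SemidirectProduct.right hh
  subst hr
  have hl : n * φ h n⁻¹ = m * φ h m⁻¹ := by simpa using congrArg SemidirectProduct.left hh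
  have hfix : φ h (n⁻¹ * m) = n⁻¹ * m := by
    have h1 : φ h n⁻¹ = n⁻¹ * (m * φ h m⁻¹) := by rw [← hl]; group
    rw [map_mul, h1, mul_assoc, mul_assoc, ← map_mul]
    simp
  exact (inv_mul_eq_one.1 (MulAut.eq_one_of_apply_eq_self hN hk hfix)).symm

/-- If the action of `H` on a group `N` of prime order larger than `|H|` is nontrivial, then
the relative subgroup commutativity degree of `H` in `N ⋊[φ] H` is at least the proportion of
subgroups of `H` acting trivially on `N`, and exceeds it by at most `2 |L(H)| / |N|`. -/
theorem SemidirectProduct.rsd_range_inr_bounds [Finite H] (hN : (Nat.card N).Prime)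
    (hNH : Nat.card H < Nat.card N) (hφ : φ ≠ 1) :
    (Nat.card (Subgroup φ.ker) : ℚ) / Nat.card (Subgroup H) ≤
        rsd (inr : H →* N ⋊[φ] H).range ∧
      rsd (inr : H →* N ⋊[φ] H).range ≤
        (Nat.card (Subgroup φ.ker) : ℚ) / Nat.card (Subgroup H) +
          2 * Nat.card (Subgroup H) / Nat.card N := by
  have : Finite N := Nat.finite_of_card_ne_zero hN.ne_zero
  have : Finite (N ⋊[φ] H) := Finite.of_equiv _ SemidirectProduct.equivProd.symm
  set G := N ⋊[φ] H
  set R : Subgroup G := (inr : H →* G).range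
  set Z : Subgroup G := φ.ker.map (inr : H →* G)
  set L := Nat.card (Subgroup G) with hL
  have hZR : Z ≤ R := Subgroup.map_le_range _ _
  have hcardR : Nat.card {K : Subgroup G // K ≤ R} = Nat.card (Subgroup H) := by
    rw [Subgroup.card_subtype_le]
    exact (Nat.card_congr
      (MonoidHom.ofInjective (f := (inr : H →* G)) inr_injective).mapSubgroup.toEquiv).symm
  have hcardZ : Nat.card {K : Subgroup G // K ≤ Z} = Nat.card (Subgroup φ.ker) := by
    rw [Subgroup.card_subtype_le]
    exact (Nat.card_congr (φ.ker.equivMapOfInjective inr inr_injective).mapSubgroup.toEquiv).symm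
  have hcardN : Nat.card {P : Subgroup G // (inl : N →* G).range ≤ P} ≤ Nat.card (Subgroup H) := by
    refine Nat.card_le_card_of_injective (fun P ↦ P.1.map (rightHom : G →* H)) fun P Q hPQ ↦ ?_
    have hker := range_inl_eq_ker_rightHom (φ := φ)
    have h := congrArg (Subgroup.comap (rightHom : G →* H)) hPQ
    simp only [Subgroup.comap_map_eq] at h
    rw [← hker, sup_eq_left.2 P.2, sup_eq_left.2 Q.2] at h
    exact Subtype.ext h
  set A := {p : {K : Subgroup G // K ≤ R} × Subgroup G // Permutes p.1.1 p.2}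
  have hlower : Nat.card (Subgroup φ.ker) * L ≤ Nat.card A := by
    rw [← hcardZ, hL, ← Nat.card_prod]
    refine Nat.card_le_card_of_injective
      (fun p ↦ (⟨(⟨p.1.1, p.1.2.trans hZR⟩, p.2),
        permutes_of_le_center (p.1.2.trans (map_inr_ker_le_center φ)) p.2⟩ : A)) ?_
    rintro ⟨⟨K, hK⟩, P⟩ ⟨⟨K', hK'⟩, P'⟩ h
    simpa [A] using h
  have hupper : Nat.card A ≤ Nat.card (Subgroup φ.ker) * L +
      Nat.card (Subgroup H) * (2 * Nat.card (Subgroup H)) := by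
    have hsum : Nat.card ({K : Subgroup G // K ≤ Z} × Subgroup G ⊕ {K : Subgroup G // K ≤ R} ×
        ({P : Subgroup G // (inl : N →* G).range ≤ P} ⊕ {P : Subgroup G // P ≤ R})) ≤
        Nat.card (Subgroup φ.ker) * L + Nat.card (Subgroup H) * (2 * Nat.card (Subgroup H)) := by
      rw [Nat.card_sum, Nat.card_prod, Nat.card_prod, Nat.card_sum, hcardR, hcardZ]
      gcongr
      lia
    let f : {K : Subgroup G // K ≤ Z} × Subgroup G ⊕ {K : Subgroup G // K ≤ R} ×
        ({P : Subgroup G // (inl : N →* G).range ≤ P} ⊕ {P : Subgroup G // P ≤ R}) →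
        {K : Subgroup G // K ≤ R} × Subgroup G :=
      Sum.elim (fun x ↦ (⟨x.1.1, x.1.2.trans hZR⟩, x.2))
        (fun x ↦ (x.1, Sum.elim Subtype.val Subtype.val x.2))
    refine le_trans ?_ ((Finite.card_range_le f).trans hsum)
    refine Nat.card_mono (Set.toFinite _) ?_
    rintro ⟨⟨K, hK⟩, P⟩ hKP
    by_cases hKZ : K ≤ Z
    · exact ⟨Sum.inl (⟨K, hKZ⟩, P), rfl⟩
    · rcases range_inl_le_or_le_range_inr φ hN hNH hK hKZ hKP with hP | hP
      · exact ⟨Sum.inr (⟨K, hK⟩, Sum.inl ⟨P, hP⟩), rfl⟩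
      · exact ⟨Sum.inr (⟨K, hK⟩, Sum.inr ⟨P, hP⟩), rfl⟩
  have hLN : Nat.card N ≤ L := card_le_card_subgroup φ hN hφ
  have hN0 : (0 : ℚ) < Nat.card N := by exact_mod_cast hN.pos
  have hL0 : (0 : ℚ) < L := hN0.trans_le (by exact_mod_cast hLN)
  have hH0 : (0 : ℚ) < Nat.card (Subgroup H) := by exact_mod_cast Nat.card_pos
  have hrsd : rsd R = (Nat.card A : ℚ) / (Nat.card (Subgroup H) * L) := by
    rw [← hcardR]
    rfl
  rw [hrsd]
  constructor
  · rw [← mul_div_mul_right _ _ hL0.ne']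
    gcongr
    exact_mod_cast hlower
  · calc (Nat.card A : ℚ) / (Nat.card (Subgroup H) * L)
        ≤ (Nat.card (Subgroup φ.ker) * L +
            Nat.card (Subgroup H) * (2 * Nat.card (Subgroup H))) /
            (Nat.card (Subgroup H) * L) := by
          gcongr
          exact_mod_cast hupper
      _ = Nat.card (Subgroup φ.ker) / Nat.card (Subgroup H) +
            2 * Nat.card (Subgroup H) / L := by
          field_simp
      _ ≤ _ := by
          gcongr

end PrimeKernel

/-- For `0 < a < b`, the fraction `a / b` is a limit of relative commutativity degrees. -/
theorem exists_rsd_mem_Icc {a b : ℕ} (ha : 0 < a) (hab : a < b) {ε : ℝ} (hε : 0 < ε) :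
    ∃ (G : Type) (_ : Group G) (_ : Fintype G) (H : Subgroup G),
      (rsd H : ℝ) ∈ Set.Icc ((a : ℝ) / b) (a / b + ε) := by
  obtain ⟨m, rfl⟩ := Nat.exists_eq_add_one_of_ne_zero ha.ne'
  obtain ⟨n, rfl⟩ := Nat.exists_eq_add_one_of_ne_zero (by lia : b ≠ 0)
  obtain ⟨B, hB⟩ := exists_nat_gt (2 * ((n + 1 : ℕ) : ℝ) / ε)
  obtain ⟨p, hp, hpB, hpmod⟩ := Nat.exists_prime_gt_modEq_one (k := 2 ^ n) (max B (2 ^ n))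
    (by positivity)
  have := Fact.mk hp
  let N := Multiplicative (ZMod p)
  let H := Multiplicative (ZMod (2 ^ n))
  have hNcard : Nat.card N = p := by simp [N]
  have hHcard : Nat.card H = 2 ^ n := by simp [H]
  have hdvd : 2 ^ n ∣ p - 1 := (Nat.modEq_iff_dvd' hp.one_le).1 hpmod.symm
  obtain ⟨g, hg⟩ : ∃ g : MulAut N, orderOf g = 2 ^ n := by
    have := Fact.mk (hNcard.symm ▸ hp : (Nat.card N).Prime)
    have : IsCyclic (MulAut N) :=
      isCyclic_of_surjective _ (IsCyclic.mulAutMulEquiv N).symm.surjective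
    obtain ⟨u, hu⟩ := IsCyclic.exists_ofOrder_eq_natCard (α := MulAut N)
    rw [IsCyclic.card_mulAut, hNcard, Nat.totient_prime hp] at hu
    refine ⟨u ^ ((p - 1) / 2 ^ n), ?_⟩
    rw [← hu] at hdvd ⊢
    exact orderOf_pow_orderOf_div (orderOf_pos u).ne' hdvd
  let e : H ≃* Subgroup.zpowers g := mulEquivOfCyclicCardEq (by rw [hHcard, Nat.card_zpowers, hg])
  let φ : H →* MulAut N :=
    ((Subgroup.zpowers g).subtype.comp e.toMonoidHom).comp (powMonoidHom (2 ^ m))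
  have hker : φ.ker = (powMonoidHom (2 ^ m) : H →* H).ker := by
    ext x
    simp [φ, MonoidHom.mem_ker, -map_pow]
  have hkercard : Nat.card φ.ker = 2 ^ m := by
    rw [hker, IsCyclic.card_powMonoidHom_ker, hHcard]
    exact Nat.gcd_eq_right (pow_dvd_pow 2 (by lia))
  have hφ : φ ≠ 1 := fun h ↦ by
    rw [h, MonoidHom.ker_one, Subgroup.card_top, hHcard] at hkercard
    have := Nat.pow_right_injective le_rfl hkercard
    lia
  have : Finite (N ⋊[φ] H) := Finite.of_equiv _ SemidirectProduct.equivProd.symm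
  obtain ⟨h1, h2⟩ := rsd_range_inr_bounds φ (hNcard.symm ▸ hp)
    (by rw [hHcard, hNcard]; exact (le_max_right _ _).trans_lt hpB) hφ
  rw [IsCyclic.card_subgroup_of_card_eq_prime_pow Nat.prime_two hkercard,
    IsCyclic.card_subgroup_of_card_eq_prime_pow Nat.prime_two hHcard] at h1 h2
  rw [hNcard] at h2
  refine ⟨N ⋊[φ] H, inferInstance, Fintype.ofFinite _, (inr : H →* N ⋊[φ] H).range, ?_, ?_⟩
  · refine le_of_eq_of_le ?_ ((Rat.cast_le (K := ℝ)).2 h1)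
    push_cast
    rfl
  · refine ((Rat.cast_le (K := ℝ)).2 h2).trans ?_
    push_cast
    gcongr
    have hBp : (B : ℝ) < p := by exact_mod_cast (le_max_left _ _).trans_lt hpB
    rw [div_le_iff₀ (by exact_mod_cast hp.pos), ← div_le_iff₀' hε]
    exact_mod_cast (hB.trans hBp).le

end

theorem rsd_dense_in_unit_interval :
    Set.Icc (0 : ℝ) 1 ⊆
      closure {x : ℝ | ∃ (G : Type) (inst : Group G) (_ : Fintype G) (H : @Subgroup G inst),
        x = ((@rsd G inst H : ℚ) : ℝ)} := by
  rw [← closure_Ioo zero_ne_one]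
  refine closure_minimal (fun x hx ↦ Metric.mem_closure_iff.2 fun ε hε ↦ ?_) isClosed_closure
  obtain ⟨q, hxq, hq⟩ := exists_rat_btwn (lt_min hx.2 (by linarith : x < x + ε / 2))
  obtain ⟨hq1, hqε⟩ := lt_min_iff.1 hq
  have hq0 : 0 < q := by exact_mod_cast hx.1.trans hxq
  have hq1' : q < 1 := by exact_mod_cast hq1
  obtain ⟨a, ha⟩ := Int.eq_ofNat_of_zero_le (Rat.num_nonneg.2 hq0.le)
  have hqa : (q : ℝ) = a / q.den := by
    rw [Rat.cast_def, ha, Int.cast_natCast]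
  have ha0 : 0 < a := by
    have := Rat.num_pos.2 hq0
    lia
  have hab : a < q.den := by
    have := Rat.num_lt_denom_iff.2 hq1'
    lia
  obtain ⟨G, inst, hfin, H, h1, h2⟩ := exists_rsd_mem_Icc ha0 hab (half_pos hε)
  rw [← hqa] at h1 h2
  refine ⟨_, ⟨G, inst, hfin, H, rfl⟩, ?_⟩
  rw [dist_comm, Real.dist_eq, abs_lt]
  constructor <;> linarith
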